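/- Let N be a layered linear deterministic network over a finite field with a single node S in the first layer (m_1 = 1) and a single node D in the last layer (m_M = 1), and define its capacity C = min{ C(Ω) : Ω ⊆ O_1 ∪ ⋯ ∪ O_M, S ∈ Ω, D ∉ Ω }. Then for every nonnegative integer R, the network N supports the rate-R flow d = (R; R) if and only if R ≤ C. -/

import Mathlib

open Matrix

/-- The rank of the block submatrix of `G` formed by the rows whose row-block index lies in `W`
and the columns whose column-block index lies in `U`. -/
noncomputable def blockRank {F : Type*} [Field F] {ρ γ ι κ : Type*} [Fintype ρ] [Fintype γ]
    [DecidableEq ι] [DecidableEq κ]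
    (G : Matrix ρ γ F) (rblk : ρ → κ) (cblk : γ → ι)
    (W : Finset κ) (U : Finset ι) : ℕ :=
  (G.submatrix (fun r : {r : ρ // rblk r ∈ W} => r.1)
               (fun c : {c : γ // cblk c ∈ U} => c.1)).rank

/-- A block matrix `G` supports the flow `(ℓ; ℓ')` of rate `R` if there is an invertible `R × R`
submatrix of `G` using exactly `ℓ j` columns from the `j`-th column block and exactly
`ℓ' k` rows from the `k`-th row block. -/
def SupportsFlow {F : Type*} [Field F] {ρ γ ι κ : Type*} [DecidableEq ι] [DecidableEq κ]
    (G : Matrix ρ γ F) (rblk : ρ → κ) (cblk : γ → ι)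
    (ℓ : ι → ℕ) (ℓ' : κ → ℕ) (R : ℕ) : Prop :=
  ∃ (r : Fin R → ρ) (c : Fin R → γ),
    Function.Injective r ∧ Function.Injective c ∧
    (∀ k : κ, (Finset.univ.filter fun i => rblk (r i) = k).card = ℓ' k) ∧
    (∀ j : ι, (Finset.univ.filter fun i => cblk (c i) = j).card = ℓ j) ∧
    IsUnit (G.submatrix r c)

section Network

/- A layered linear deterministic network with `M + 1` layers indexed by `Fin (M+1)`, where layer
`i` has `m i` nodes, and for each hop `i : Fin M` a block matrix `G i` whose column blocks are
indexed by the nodes of layer `i.castSucc` and whose row blocks are indexed by the nodes of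
layer `i.succ`. -/
variable {F : Type*} [Field F] {M : ℕ} {m : Fin (M + 1) → ℕ}
  {ρ γ : Fin M → Type*}

/-- The capacity `C(Ω) = ∑_i rank (G_i(Ω))` of a cut `Ω`, where `G_i(Ω)` consists of the column
blocks of `G i` indexed by `Ω ∩ O_i` and the row blocks indexed by `O_{i+1} ∖ Ω`. -/
noncomputable def cutCap [∀ i, Fintype (ρ i)] [∀ i, Fintype (γ i)]
    (G : ∀ i : Fin M, Matrix (ρ i) (γ i) F)
    (rblk : ∀ i : Fin M, ρ i → Fin (m i.succ))
    (cblk : ∀ i : Fin M, γ i → Fin (m i.castSucc))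
    (Ω : ∀ i : Fin (M + 1), Finset (Fin (m i))) : ℕ :=
  ∑ i : Fin M, blockRank (G i) (rblk i) (cblk i) ((Ω i.succ)ᶜ) (Ω i.castSucc)

/-- The network supports the rate-`R` flow `(ℓfirst; ℓlast)` if there are per-layer nonnegative
integers `ℓ i`, agreeing with `ℓfirst` on the first layer and with `ℓlast` on the last layer,
such that every block matrix `G i` supports the flow `(ℓ i.castSucc; ℓ i.succ)` of rate `R`. -/
def NetSupports [∀ i, Fintype (ρ i)] [∀ i, Fintype (γ i)]
    (G : ∀ i : Fin M, Matrix (ρ i) (γ i) F)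
    (rblk : ∀ i : Fin M, ρ i → Fin (m i.succ))
    (cblk : ∀ i : Fin M, γ i → Fin (m i.castSucc))
    (ℓfirst : Fin (m 0) → ℕ) (ℓlast : Fin (m (Fin.last M)) → ℕ) (R : ℕ) : Prop :=
  ∃ ℓ : ∀ i : Fin (M + 1), Fin (m i) → ℕ,
    ℓ 0 = ℓfirst ∧ ℓ (Fin.last M) = ℓlast ∧
    ∀ i : Fin M, SupportsFlow (G i) (rblk i) (cblk i) (ℓ i.castSucc) (ℓ i.succ) R

end Network

/-- **Rado's theorem** for vector families. -/
theorem exists_linearIndependent_transversal {K V ι E : Type*} [Field K] [AddCommGroup V]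
    [Module K V] [FiniteDimensional K V] [Fintype ι] [DecidableEq E] (v : E → V)
    (A : ι → Finset E)
    (h : ∀ J : Finset ι, J.card ≤
      Module.finrank K (Submodule.span K (v '' {e | ∃ j ∈ J, e ∈ A j}))) :
    ∃ x : ι → E, (∀ i, x i ∈ A i) ∧ LinearIndependent K (v ∘ x) := by
  classical
  induction hn : ∑ i, (A i).card using Nat.strong_induction_on generalizing A with
  | _ n ih =>
  subst hn
  by_cases hcard : ∀ i, (A i).card ≤ 1
  · have hne : ∀ i, (A i).Nonempty := by
      intro i
      by_contra hi
      rw [Finset.not_nonempty_iff_eq_empty] at hi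
      have := h {i}
      simp [hi] at this
    choose x hx using hne
    refine ⟨x, hx, linearIndependent_iff_card_le_finrank_span.2 ?_⟩
    refine (h Finset.univ).trans (Submodule.finrank_mono (Submodule.span_mono ?_))
    rintro _ ⟨e, ⟨j, -, hj⟩, rfl⟩
    exact ⟨j, by rw [Function.comp, Finset.card_le_one.1 (hcard j) _ (hx j) _ hj]⟩
  push Not at hcard
  obtain ⟨i, hi⟩ := hcard
  obtain ⟨x, hx, y, hy, hxy⟩ := Finset.one_lt_card.1 hi
  let A' : E → ι → Finset E := fun z => Function.update A i ((A i).erase z)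
  have hA'sub : ∀ z j, A' z j ⊆ A j := by
    intro z j
    by_cases hj : j = i
    · subst hj; simp [A', Finset.erase_subset]
    · simp [A', hj]
  have critical : ∀ z ∈ A i,
      (∃ x : ι → E, (∀ i, x i ∈ A i) ∧ LinearIndependent K (v ∘ x)) ∨
      ∃ J : Finset ι, i ∈ J ∧
        Module.finrank K (Submodule.span K (v '' {e | ∃ j ∈ J, e ∈ A' z j})) < J.card := by
    intro z hz
    by_cases hJ : ∀ J : Finset ι, J.card ≤
        Module.finrank K (Submodule.span K (v '' {e | ∃ j ∈ J, e ∈ A' z j}))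
    · left
      obtain ⟨x, hx, hli⟩ := ih _ (Finset.sum_lt_sum (fun j _ => Finset.card_le_card (hA'sub z j))
        ⟨i, Finset.mem_univ _, by
          simpa [A'] using Finset.card_erase_lt_of_mem hz⟩) (A' z) hJ rfl
      exact ⟨x, fun j => hA'sub z j (hx j), hli⟩
    · right
      push Not at hJ
      obtain ⟨J, hJ⟩ := hJ
      refine ⟨J, ?_, hJ⟩
      by_contra hiJ
      refine (h J).not_gt (lt_of_eq_of_lt ?_ hJ)
      have hA : ∀ j ∈ J, A' z j = A j := fun j hj => by
        simp [A', ne_of_mem_of_not_mem hj hiJ]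
      have hset : {e | ∃ j ∈ J, e ∈ A' z j} = {e | ∃ j ∈ J, e ∈ A j} := by
        ext e
        exact exists_congr fun j => and_congr_right fun hj => by rw [hA j hj]
      rw [hset]
  obtain hdone | ⟨J₁, hi₁, h₁⟩ := critical x hx
  · exact hdone
  obtain hdone | ⟨J₂, hi₂, h₂⟩ := critical y hy
  · exact hdone
  exfalso
  set U₁ := Submodule.span K (v '' {e | ∃ j ∈ J₁, e ∈ A' x j})
  set U₂ := Submodule.span K (v '' {e | ∃ j ∈ J₂, e ∈ A' y j})
  have hsup : (J₁ ∪ J₂).card ≤ Module.finrank K ↥(U₁ ⊔ U₂) := by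
    refine (h _).trans (Submodule.finrank_mono (Submodule.span_le.2 ?_))
    rintro _ ⟨e, ⟨j, hj, he⟩, rfl⟩
    by_cases hji : j = i
    · subst hji
      by_cases hex : e = x
      · refine Submodule.mem_sup_right (Submodule.subset_span ⟨e, ⟨j, hi₂, ?_⟩, rfl⟩)
        simp [A', hex, hxy, hx]
      · refine Submodule.mem_sup_left (Submodule.subset_span ⟨e, ⟨j, hi₁, ?_⟩, rfl⟩)
        simp [A', hex, he]
    · rcases Finset.mem_union.1 hj with hj | hj
      · exact Submodule.mem_sup_left (Submodule.subset_span ⟨e, ⟨j, hj, by simpa [A', hji]⟩, rfl⟩)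
      · exact Submodule.mem_sup_right (Submodule.subset_span ⟨e, ⟨j, hj, by simpa [A', hji]⟩, rfl⟩)
  have hinf : ((J₁ ∩ J₂).erase i).card ≤ Module.finrank K ↥(U₁ ⊓ U₂) := by
    refine (h _).trans (Submodule.finrank_mono (Submodule.span_le.2 ?_))
    rintro _ ⟨e, ⟨j, hj, he⟩, rfl⟩
    simp only [Finset.mem_erase, Finset.mem_inter] at hj
    exact ⟨Submodule.subset_span ⟨e, ⟨j, hj.2.1, by simpa [A', hj.1]⟩, rfl⟩,
      Submodule.subset_span ⟨e, ⟨j, hj.2.2, by simpa [A', hj.1]⟩, rfl⟩⟩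
  have hmod := Submodule.finrank_sup_add_finrank_inf_eq U₁ U₂
  have hui := Finset.card_union_add_card_inter J₁ J₂
  have her := Finset.card_erase_add_one (Finset.mem_inter.2 ⟨hi₁, hi₂⟩)
  omega

/-- A capacitated form of Rado's theorem for a partition of a vector family into blocks. -/
theorem exists_linearIndepOn_card_fiber_eq {K V E N : Type*} [Field K] [AddCommGroup V]
    [Module K V] [FiniteDimensional K V] [Fintype E] [Fintype N] [DecidableEq E] [DecidableEq N]
    (v : E → V) (p : E → N) (n : N → ℕ)
    (h : ∀ J : Finset N, ∑ w ∈ J, n w ≤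
      Module.finrank K (Submodule.span K (v '' {e | p e ∈ J}))) :
    ∃ B : Finset E, LinearIndepOn K v (B : Set E) ∧
      ∀ w, Fintype.card {e // e ∈ B ∧ p e = w} = n w := by
  obtain ⟨x, hx, hli⟩ := exists_linearIndependent_transversal (ι := Σ w, Fin (n w)) v
    (fun i => {e | p e = i.1}) fun K => by
      have hK : K.card ≤
          ((K.image Sigma.fst).sigma fun w => (Finset.univ : Finset (Fin (n w)))).card :=
        Finset.card_le_card fun i hi => by
          simpa using ⟨i.2, hi⟩
      rw [Finset.card_sigma] at hK
      simp only [Finset.card_univ, Fintype.card_fin] at hK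
      refine (hK.trans (h _)).trans (Submodule.finrank_mono (Submodule.span_mono ?_))
      rintro _ ⟨e, he, rfl⟩
      obtain ⟨i, hi, hie⟩ := Finset.mem_image.1 he
      exact ⟨e, ⟨i, hi, by simp [hie]⟩, rfl⟩
  have hinj : Function.Injective x := hli.injective.of_comp
  simp only [Finset.mem_filter, Finset.mem_univ, true_and] at hx
  refine ⟨Finset.univ.image x, ?_, fun w => ?_⟩
  · rw [Finset.coe_image, Finset.coe_univ, Set.image_univ]
    exact (linearIndepOn_range_iff hinj v).2 hli
  · rw [← Fintype.card_fin (n w)]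
    symm
    refine Fintype.card_of_bijective
      (f := fun t => ⟨x ⟨w, t⟩, Finset.mem_image_of_mem _ (Finset.mem_univ _), hx _⟩) ⟨?_, ?_⟩
    · intro t t' htt
      simpa using hinj (Subtype.ext_iff.1 htt)
    · rintro ⟨e, he, hew⟩
      obtain ⟨⟨w', t⟩, -, rfl⟩ := Finset.mem_image.1 he
      obtain rfl : w' = w := (hx _).symm.trans hew
      exact ⟨t, rfl⟩

theorem Fintype.card_subtype_eq_sum_fiber {α β : Type*} [Fintype α] [Fintype β] [DecidableEq β]
    (P : α → Prop) [DecidablePred P] (f : α → β) :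
    Fintype.card {a // P a} = ∑ b, Fintype.card {a // P a ∧ f a = b} := by
  simp only [Fintype.card_subtype]
  rw [Finset.card_eq_sum_card_fiberwise (f := f) (t := Finset.univ) (by simp)]
  simp only [Finset.filter_filter]

theorem Fintype.card_sigma_subtype_eq {I : Type*} {A : I → Type*} [Fintype I]
    [∀ i, Fintype (A i)] (P : ∀ i, A i → Prop) [∀ i, DecidablePred (P i)] (i₀ : I)
    (hP : ∀ i a, P i a → i = i₀) :
    Fintype.card {e : Σ i, A i // P e.1 e.2} = Fintype.card {a // P i₀ a} := by
  symm
  refine Fintype.card_of_bijective (f := fun a => ⟨⟨i₀, a.1⟩, a.2⟩) ⟨?_, ?_⟩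
  · intro a a' h
    simpa [Subtype.ext_iff] using h
  · rintro ⟨⟨i, a⟩, h⟩
    obtain rfl := hP i a h
    exact ⟨⟨a, h⟩, rfl⟩

section Layer

variable {F : Type*} [Field F] {ρ γ ι κ : Type*} [Fintype ρ]
  [DecidableEq ι] [DecidableEq κ]

/-- A supported flow obeys the cut bound: the columns used in `U`, minus the rows used outside
`W`, number at most the rank of the block submatrix on `W` and `U`. -/
theorem SupportsFlow.sum_add_sum_le [Fintype γ] {G : Matrix ρ γ F} {rblk : ρ → κ} {cblk : γ → ι}
    {ℓ : ι → ℕ} {ℓ' : κ → ℕ} {R : ℕ} (h : SupportsFlow G rblk cblk ℓ ℓ' R)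
    (W : Finset κ) (U : Finset ι) :
    ∑ j ∈ U, ℓ j + ∑ k ∈ W, ℓ' k ≤ R + blockRank G rblk cblk W U := by
  classical
  obtain ⟨r, c, -, -, hr, hc, hu⟩ := h
  let P : Finset (Fin R) := {i | rblk (r i) ∈ W}
  let Q : Finset (Fin R) := {i | cblk (c i) ∈ U}
  have hP : P.card = ∑ k ∈ W, ℓ' k := by
    rw [Finset.card_eq_sum_card_fiberwise (f := fun i => rblk (r i)) (t := W)
      (fun i hi => by simpa [P] using hi)]
    refine Finset.sum_congr rfl fun k hk => ?_
    rw [← hr k, Finset.filter_filter]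
    congr 1; ext i; simp; rintro rfl; exact hk
  have hQ : Q.card = ∑ j ∈ U, ℓ j := by
    rw [Finset.card_eq_sum_card_fiberwise (f := fun i => cblk (c i)) (t := U)
      (fun i hi => by simpa [Q] using hi)]
    refine Finset.sum_congr rfl fun k hk => ?_
    rw [← hc k, Finset.filter_filter]
    congr 1; ext i; simp; rintro rfl; exact hk
  let H := G.submatrix r c
  let T : Matrix P Q F := H.submatrix (↑) (↑)
  have hT : T.rank ≤ blockRank G rblk cblk W U := by
    have hPm : ∀ i : P, rblk (r i) ∈ W := fun i => (Finset.mem_filter.1 i.2).2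
    have hQm : ∀ i : Q, cblk (c i) ∈ U := fun i => (Finset.mem_filter.1 i.2).2
    exact rank_submatrix_le (G.submatrix (fun s : {s : ρ // rblk s ∈ W} => s.1)
      (fun s : {s : γ // cblk s ∈ U} => s.1)) (fun i : P => ⟨r i, hPm i⟩)
      (fun i : Q => ⟨c i, hQm i⟩)
  let T' : Matrix {i // i ∉ P} Q F := H.submatrix (↑) (↑)
  have hinj : Function.Injective (T'.mulVecLin.domRestrict (LinearMap.ker T.mulVecLin)) := by
    rw [← LinearMap.ker_eq_bot, LinearMap.ker_eq_bot']
    rintro ⟨x, hx⟩ hx'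
    have hcols : LinearIndependent F (fun q : Q => H.col q) :=
      (linearIndependent_cols_iff_isUnit.2 hu).comp _ Subtype.val_injective
    have hzero : ∑ q : Q, x q • H.col q = 0 := by
      ext i
      by_cases hi : i ∈ P
      · simpa [mulVec, dotProduct, T, mul_comm] using congrFun hx ⟨i, hi⟩
      · simpa [mulVec, dotProduct, T', mul_comm] using congrFun hx' ⟨i, hi⟩
    ext q
    exact Fintype.linearIndependent_iff.1 hcols x hzero q
  have hker := LinearMap.finrank_le_finrank_of_injective hinj
  have hrn := LinearMap.finrank_range_add_finrank_ker T.mulVecLin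
  have hcard : Fintype.card {i // i ∉ P} = R - P.card := by
    rw [Fintype.card_subtype_compl]; simp
  have hPR : P.card ≤ R := by simpa using P.card_le_univ
  simp only [Module.finrank_fintype_fun_eq_card, Fintype.card_coe, hcard] at hker hrn
  rw [← hP, ← hQ]
  change Module.finrank F (LinearMap.range T.mulVecLin) ≤ _ at hT
  omega

/-- The columns of the matrix `[1 | G]`. -/
def augCol [DecidableEq ρ] (G : Matrix ρ γ F) : ρ ⊕ γ → ρ → F :=
  (fromCols 1 G).col

/-- The columns of `[1 | G]` given by the unit columns outside `W` together with the columns of `G`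
in `U` have rank at least the number of the former plus the rank of the block on `W` and `U`. -/
theorem exists_linearIndependent_augCol [Fintype γ] [DecidableEq ρ] (G : Matrix ρ γ F) (rblk : ρ → κ)
    (cblk : γ → ι) (W : Finset κ) (U : Finset ι) :
    ∃ x : {r // rblk r ∉ W} ⊕ Fin (blockRank G rblk cblk W U) → ρ ⊕ γ,
      LinearIndependent F (augCol G ∘ x) ∧
      ∀ t, Sum.elim (fun r => rblk r ∉ W) (fun c => cblk c ∈ U) (x t) := by
  let A := G.submatrix (fun r : {r : ρ // rblk r ∈ W} => r.1)
    (fun c : {c : γ // cblk c ∈ U} => c.1)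
  have hA : blockRank G rblk cblk W U = Module.finrank F (Submodule.span F (Set.range A.col)) :=
    A.rank_eq_finrank_span_cols
  obtain ⟨f, hf, -, hli⟩ := Submodule.exists_fun_fin_finrank_span_eq F (Set.range A.col)
  rw [hA]
  choose a ha using hf
  refine ⟨Sum.elim (fun r => .inl r) (fun k => .inr (a k)), ?_, ?_⟩
  · rw [Fintype.linearIndependent_iff]
    intro g hg
    rw [Fintype.sum_sum_type] at hg
    have hk : ∀ k, g (.inr k) = 0 := by
      refine Fintype.linearIndependent_iff.1 hli _ ?_
      ext s
      have := congrFun hg s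
      have hs : ∀ r : {r // rblk r ∉ W}, (1 : Matrix ρ ρ F) s r = 0 := fun r =>
        one_apply_ne fun h => r.2 (h ▸ s.2)
      simpa [augCol, hs, ← ha, A] using this
    rintro (r | k)
    · have := congrFun hg r
      simpa [augCol, hk, one_apply, Subtype.coe_inj] using this
    · exact hk k
  · rintro (r | k)
    · exact r.2
    · exact (a k).2

/-- A set of independent columns of `[1 | G]` has an invertible submatrix of `G` given by the
columns of `G` it contains and the unit columns it misses. -/
theorem isUnit_submatrix_of_linearIndepOn_augCol [DecidableEq ρ] {G : Matrix ρ γ F}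
    {B : Finset (ρ ⊕ γ)} (hB : LinearIndepOn F (augCol G) (B : Set (ρ ⊕ γ))) {R : ℕ}
    {r : Fin R → ρ} {c : Fin R → γ} (hc : Function.Injective c) (hcB : ∀ i, .inr (c i) ∈ B)
    (hrB : ∀ s, s ∉ Set.range r → .inl s ∈ B) : IsUnit (G.submatrix r c) := by
  classical
  rw [← linearIndependent_cols_iff_isUnit, Fintype.linearIndependent_iff]
  intro g hg
  let x : {s // s ∉ Set.range r} ⊕ Fin R → B :=
    Sum.elim (fun s => ⟨.inl s.1, hrB s s.2⟩) (fun i => ⟨.inr (c i), hcB i⟩)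
  have hx : Function.Injective x := by
    rintro (s | i) (s' | i') h <;> simp [x, Subtype.ext_iff] at h ⊢
    · exact h
    · exact hc h
  have hli : LinearIndependent F (fun t => augCol G (x t)) := hB.comp x hx
  let w : ρ → F := ∑ i, g i • G.col (c i)
  have hw : ∀ i, w (r i) = 0 := fun i => by
    simpa [w] using congrFun hg i
  have hsum := Fintype.linearIndependent_iff.1 hli (Sum.elim (fun s => - w s) g) (by
    ext t
    rw [Fintype.sum_sum_type]
    by_cases ht : t ∈ Set.range r
    · obtain ⟨i, rfl⟩ := ht
      have hs : ∀ s : {s // s ∉ Set.range r}, (1 : Matrix ρ ρ F) (r i) s = 0 := fun s =>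
        one_apply_ne fun h => s.2 ⟨i, h⟩
      have := hw i
      simp only [w, Finset.sum_apply] at this
      simpa [x, augCol, hs] using this
    · rw [Pi.add_apply, Finset.sum_apply, Finset.sum_eq_single ⟨t, ht⟩]
      · simp [x, augCol, w]
      · intro s _ hs
        have : t ≠ s := fun h => hs (Subtype.ext h.symm)
        simp [x, augCol, one_apply_ne this]
      · simp)
  exact fun i => hsum (.inr i)

theorem supportsFlow_of_linearIndepOn_augCol [Fintype γ] [DecidableEq ρ] [DecidableEq γ] {G : Matrix ρ γ F}
    {B : Finset (ρ ⊕ γ)} (hB : LinearIndepOn F (augCol G) (B : Set (ρ ⊕ γ)))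
    (rblk : ρ → κ) (cblk : γ → ι) {R : ℕ}
    (hr : Fintype.card {s // .inl s ∉ B} = R) (hc : Fintype.card {c // .inr c ∈ B} = R) :
    SupportsFlow G rblk cblk (fun j => Fintype.card {c // .inr c ∈ B ∧ cblk c = j})
      (fun k => Fintype.card {s // .inl s ∉ B ∧ rblk s = k}) R := by
  let er := (Fintype.equivFinOfCardEq hr).symm
  let ec := (Fintype.equivFinOfCardEq hc).symm
  refine ⟨fun i => er i, fun i => ec i, Subtype.val_injective.comp er.injective,
    Subtype.val_injective.comp ec.injective, fun k => ?_, fun j => ?_,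
    isUnit_submatrix_of_linearIndepOn_augCol hB (Subtype.val_injective.comp ec.injective)
      (fun i => (ec i).2) fun s hs => ?_⟩
  · rw [← Fintype.card_subtype]
    exact Fintype.card_congr ((er.subtypeEquiv fun i => Iff.rfl).trans
      (Equiv.subtypeSubtypeEquivSubtypeInter _ fun s => rblk s = k))
  · rw [← Fintype.card_subtype]
    exact Fintype.card_congr ((ec.subtypeEquiv fun i => Iff.rfl).trans
      (Equiv.subtypeSubtypeEquivSubtypeInter _ fun s => cblk s = j))
  · by_contra h
    exact hs ⟨er.symm ⟨s, h⟩, by simp⟩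

theorem card_inr_le_card_inl_compl [Fintype γ] [DecidableEq ρ] [DecidableEq γ] {G : Matrix ρ γ F}
    {B : Finset (ρ ⊕ γ)} (hB : LinearIndepOn F (augCol G) (B : Set (ρ ⊕ γ))) :
    Fintype.card {c // .inr c ∈ B} ≤ Fintype.card {s // .inl s ∉ B} := by
  let x : {s // .inl s ∈ B} ⊕ {c // .inr c ∈ B} → B :=
    Sum.elim (fun s => ⟨.inl s.1, s.2⟩) (fun c => ⟨.inr c.1, c.2⟩)
  have hx : Function.Injective x := by
    rintro (s | i) (s' | i') h <;> simp [x, Subtype.ext_iff] at h ⊢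
    · exact h
    · exact h
  have hli : LinearIndependent F (fun t => augCol G (x t)) := hB.comp x hx
  have h1 := hli.fintype_card_le_finrank
  have h2 := Fintype.card_subtype_compl (fun s : ρ => .inl s ∈ B)
  have h3 := Fintype.card_subtype_le (fun s : ρ => .inl s ∈ B)
  simp only [Fintype.card_sum, Module.finrank_fintype_fun_eq_card] at h1
  omega

end Layer

theorem Fin.le_sum_add_last {n : ℕ} (f : Fin (n + 1) → ℕ) (c : Fin n → ℕ)
    (h : ∀ i, f i.castSucc ≤ c i + f i.succ) : f 0 ≤ ∑ i, c i + f (Fin.last n) := by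
  induction n with
  | zero => simp
  | succ n ih =>
    have h0 := h 0
    have h1 : f 1 ≤ ∑ i : Fin n, c i.succ + f (Fin.last (n + 1)) :=
      ih (fun i => f i.succ) (fun i => c i.succ) fun i => h i.succ
    rw [Fin.sum_univ_succ]
    rw [Fin.castSucc_zero, Fin.succ_zero_eq_one] at h0
    omega

theorem SupportsFlow.sum_snd {F : Type*} [Field F] {ρ γ ι κ : Type*} [DecidableEq ι]
    [DecidableEq κ] [Fintype κ] {G : Matrix ρ γ F} {rblk : ρ → κ} {cblk : γ → ι}
    {ℓ : ι → ℕ} {ℓ' : κ → ℕ} {R : ℕ} (h : SupportsFlow G rblk cblk ℓ ℓ' R) :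
    ∑ k, ℓ' k = R := by
  obtain ⟨r, c, -, -, hr, -, -⟩ := h
  simp_rw [← hr]
  rw [← Finset.card_eq_sum_card_fiberwise (by simp)]
  simp

section Network

variable {F : Type*} [Field F] {M : ℕ} {m : Fin (M + 1) → ℕ} {ρ γ : Fin M → Type*}
  {G : ∀ i : Fin M, Matrix (ρ i) (γ i) F}
  {rblk : ∀ i : Fin M, ρ i → Fin (m i.succ)} {cblk : ∀ i : Fin M, γ i → Fin (m i.castSucc)}

/-- The column of `∏ i, [1 | G i]` indexed by `e`. -/
def netCol [∀ i, DecidableEq (ρ i)] (G : ∀ i : Fin M, Matrix (ρ i) (γ i) F)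
    (e : Σ i, ρ i ⊕ γ i) : ∀ i, ρ i → F :=
  Pi.single e.1 (augCol (G e.1) e.2)

/-- The node to which a column of `∏ i, [1 | G i]` belongs: unit columns belong to the node
receiving the corresponding row, and columns of `G i` to the node transmitting them. -/
def netNode (rblk : ∀ i : Fin M, ρ i → Fin (m i.succ))
    (cblk : ∀ i : Fin M, γ i → Fin (m i.castSucc)) (e : Σ i, ρ i ⊕ γ i) :
    Σ k, Fin (m k) :=
  Sum.elim (fun r => ⟨e.1.succ, rblk e.1 r⟩) (fun c => ⟨e.1.castSucc, cblk e.1 c⟩) e.2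

theorem linearIndepOn_augCol_of_netCol [∀ i, DecidableEq (ρ i)] {B : Set (Σ i, ρ i ⊕ γ i)}
    (hB : LinearIndepOn F (netCol G) B) (i : Fin M) :
    LinearIndepOn F (augCol (G i)) {e | ⟨i, e⟩ ∈ B} := by
  let f : ρ i ⊕ γ i → Σ i, ρ i ⊕ γ i := fun e => ⟨i, e⟩
  have hf : Function.Injective f := fun e e' h => by simpa [f] using h
  refine LinearIndepOn.of_comp (LinearMap.single F (fun i => ρ i → F) i) ?_
  change LinearIndepOn F (netCol G ∘ f) (f ⁻¹' B)
  exact (hB.mono (Set.image_preimage_subset f B)).comp_of_image hf.injOn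

variable [∀ i, Fintype (ρ i)] [∀ i, Fintype (γ i)]

theorem NetSupports.sum_first_le {ℓ₀ : Fin (m 0) → ℕ} {ℓ₁ : Fin (m (Fin.last M)) → ℕ} {R : ℕ}
    (h : NetSupports G rblk cblk ℓ₀ ℓ₁ R) (Ω : ∀ i : Fin (M + 1), Finset (Fin (m i))) :
    ∑ j ∈ Ω 0, ℓ₀ j ≤ cutCap G rblk cblk Ω + ∑ j ∈ Ω (Fin.last M), ℓ₁ j := by
  obtain ⟨ℓ, rfl, rfl, h⟩ := h
  refine Fin.le_sum_add_last (fun i => ∑ j ∈ Ω i, ℓ i j) _ fun i => ?_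
  have h1 := (h i).sum_add_sum_le (Ω i.succ)ᶜ (Ω i.castSucc)
  have h2 := (h i).sum_snd
  have h3 := Finset.sum_add_sum_compl (Ω i.succ) (ℓ i.succ)
  omega

/-- The number of rows received by the node `v`. -/
def rowCount (rblk : ∀ i : Fin M, ρ i → Fin (m i.succ)) (v : Σ k, Fin (m k)) : ℕ :=
  Fintype.card {e : Σ i, ρ i // (⟨e.1.succ, rblk e.1 e.2⟩ : Σ k, Fin (m k)) = v}

theorem sum_rowCount (J : Finset (Σ k, Fin (m k))) :
    ∑ v ∈ J, rowCount rblk v =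
      ∑ i : Fin M, Fintype.card {r // (⟨i.succ, rblk i r⟩ : Σ k, Fin (m k)) ∈ J} := by
  classical
  rw [← Fintype.card_sigma]
  let f : (Σ i, ρ i) → Σ k, Fin (m k) := fun e => ⟨e.1.succ, rblk e.1 e.2⟩
  have : ∑ v ∈ J, rowCount rblk v = Fintype.card {e // f e ∈ J} := by
    rw [Fintype.card_subtype, Finset.card_eq_sum_card_fiberwise (f := f) (t := J)
      (fun e he => by simpa using he)]
    refine Finset.sum_congr rfl fun v hv => ?_
    rw [rowCount, Fintype.card_subtype, Finset.filter_filter]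
    congr 1
    ext e
    simp only [Finset.mem_filter, Finset.mem_univ, true_and]
    exact ⟨fun h => ⟨by rw [show f e = v from h]; exact hv, h⟩, And.right⟩
  rw [this]
  exact Fintype.card_congr
    ⟨fun e => ⟨e.1.1, e.1.2, e.2⟩, fun e => ⟨⟨e.1, e.2.1⟩, e.2.2⟩, fun _ => rfl, fun _ => rfl⟩

theorem cutCap_add_sum_rowCount_le [∀ i, DecidableEq (ρ i)] (J : Finset (Σ k, Fin (m k))) :
    cutCap G rblk cblk (fun k => {j | ⟨k, j⟩ ∈ J}) + ∑ v ∈ J, rowCount rblk v ≤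
      Module.finrank F (Submodule.span F
        (netCol G '' {e | netNode rblk cblk e ∈ J})) := by
  classical
  let Ω : ∀ k : Fin (M + 1), Finset (Fin (m k)) := fun k => {j | ⟨k, j⟩ ∈ J}
  choose x hx hxJ using fun i => exists_linearIndependent_augCol (G i) (rblk i) (cblk i)
    (Ω i.succ)ᶜ (Ω i.castSucc)
  have hli := Pi.linearIndependent_single _ hx
  have hcard := finrank_span_eq_card hli
  rw [Fintype.card_sigma] at hcard
  simp only [Fintype.card_sum, Fintype.card_fin, Finset.sum_add_distrib] at hcard
  have hrow : ∑ v ∈ J, rowCount rblk v =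
      ∑ i : Fin M, Fintype.card {r // rblk i r ∉ (Ω i.succ)ᶜ} := by
    rw [sum_rowCount]
    exact Finset.sum_congr rfl fun i _ => Fintype.card_congr
      (Equiv.subtypeEquivRight fun r => by simp [Ω])
  rw [add_comm, hrow, cutCap, ← hcard]
  refine Submodule.finrank_mono (Submodule.span_mono ?_)
  rintro _ ⟨⟨i, t⟩, rfl⟩
  refine ⟨⟨i, x i t⟩, ?_, rfl⟩
  have := hxJ i t
  rcases hxt : x i t with r | c <;> simp [hxt, Ω] at this <;>
    simpa [netNode] using this

theorem cutCap_le_sum_rowCount (J : Finset (Σ k, Fin (m k))) :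
    cutCap G rblk cblk (fun k => {j | ⟨k, j⟩ ∈ J}) ≤ ∑ v ∈ Jᶜ, rowCount rblk v := by
  rw [sum_rowCount]
  refine Finset.sum_le_sum fun i _ => (rank_le_card_height _).trans_eq ?_
  exact Fintype.card_congr (Equiv.subtypeEquivRight fun r => by simp)

theorem card_netNode_fiber_add [∀ i, DecidableEq (ρ i)] [∀ i, DecidableEq (γ i)]
    (B : Finset (Σ i, ρ i ⊕ γ i)) (v : Σ k, Fin (m k)) :
    Fintype.card {e // e ∈ B ∧ netNode rblk cblk e = v} +
      Fintype.card {e : Σ i, ρ i // ⟨e.1, .inl e.2⟩ ∉ B ∧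
        (⟨e.1.succ, rblk e.1 e.2⟩ : Σ k, Fin (m k)) = v} =
    Fintype.card {e : Σ i, γ i // ⟨e.1, .inr e.2⟩ ∈ B ∧
        (⟨e.1.castSucc, cblk e.1 e.2⟩ : Σ k, Fin (m k)) = v} + rowCount rblk v := by
  simp only [rowCount, Fintype.card_subtype, Finset.card_filter, Fintype.sum_sigma,
    Fintype.sum_sum_type]
  simp only [netNode, Sum.elim_inl, Sum.elim_inr]
  rw [← Finset.sum_add_distrib, ← Finset.sum_add_distrib]
  refine Finset.sum_congr rfl fun i _ => ?_
  rw [add_right_comm, ← Finset.sum_add_distrib, add_comm]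
  congr 1
  refine Finset.sum_congr rfl fun r _ => ?_
  by_cases hB : (⟨i, .inl r⟩ : Σ i, ρ i ⊕ γ i) ∈ B <;> simp [hB]

/-- An independent set of columns of `∏ i, [1 | G i]` with as many columns of `G` as missing unit
columns at each node other than the source and the destination yields a flow. -/
theorem netSupports_of_linearIndepOn_netCol [∀ i, DecidableEq (ρ i)] [∀ i, DecidableEq (γ i)]
    {S : Fin (m 0)} {D : Fin (m (Fin.last M))} (hS : ∀ j, j = S) (hD : ∀ j, j = D) {R : ℕ}
    {B : Finset (Σ i, ρ i ⊕ γ i)} (hB : LinearIndepOn F (netCol G) (B : Set (Σ i, ρ i ⊕ γ i)))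
    (hbal : ∀ v : Σ k, Fin (m k),
      Fintype.card {e : Σ i, γ i // ⟨e.1, .inr e.2⟩ ∈ B ∧
        (⟨e.1.castSucc, cblk e.1 e.2⟩ : Σ k, Fin (m k)) = v} +
        (if v = ⟨Fin.last M, D⟩ then R else 0) =
      Fintype.card {e : Σ i, ρ i // ⟨e.1, .inl e.2⟩ ∉ B ∧
        (⟨e.1.succ, rblk e.1 e.2⟩ : Σ k, Fin (m k)) = v} +
        (if v = ⟨0, S⟩ then R else 0)) :
    NetSupports G rblk cblk (fun _ => R) (fun _ => R) R := by
  let t : (Σ k, Fin (m k)) → ℕ := fun v => if v = ⟨Fin.last M, D⟩ then R else 0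
  let s : (Σ k, Fin (m k)) → ℕ := fun v => if v = ⟨0, S⟩ then R else 0
  replace hbal : ∀ v : Σ k, Fin (m k),
      Fintype.card {e : Σ i, γ i // ⟨e.1, .inr e.2⟩ ∈ B ∧
        (⟨e.1.castSucc, cblk e.1 e.2⟩ : Σ k, Fin (m k)) = v} + t v =
      Fintype.card {e : Σ i, ρ i // ⟨e.1, .inl e.2⟩ ∉ B ∧
        (⟨e.1.succ, rblk e.1 e.2⟩ : Σ k, Fin (m k)) = v} + s v := hbal
  let ℓ : ∀ k, Fin (m k) → ℕ := fun k j =>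
    Fintype.card {e : Σ i, γ i // ⟨e.1, .inr e.2⟩ ∈ B ∧
      (⟨e.1.castSucc, cblk e.1 e.2⟩ : Σ k, Fin (m k)) = ⟨k, j⟩} + t ⟨k, j⟩
  let L : ∀ i, Finset (ρ i ⊕ γ i) := fun i => {e | ⟨i, e⟩ ∈ B}
  have hL : ∀ i, LinearIndepOn F (augCol (G i)) (L i : Set (ρ i ⊕ γ i)) := fun i => by
    simpa [L] using linearIndepOn_augCol_of_netCol hB i
  have hcol : ∀ i j, ℓ i.castSucc j =
      Fintype.card {c // .inr c ∈ L i ∧ cblk i c = j} := fun i j => by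
    have : t ⟨i.castSucc, j⟩ = 0 := if_neg fun he => by
      exact (Fin.castSucc_lt_last i).ne (congrArg Sigma.fst he)
    simp only [ℓ, this, add_zero]
    rw [Fintype.card_sigma_subtype_eq (fun i' c => ⟨i', .inr c⟩ ∈ B ∧
      (⟨i'.castSucc, cblk i' c⟩ : Σ k, Fin (m k)) = ⟨i.castSucc, j⟩) i fun i' c hc =>
      Fin.castSucc_injective _ (congrArg Sigma.fst hc.2)]
    exact Fintype.card_congr (Equiv.subtypeEquivRight fun c => by simp [L])
  have hrow : ∀ i j, ℓ i.succ j =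
      Fintype.card {r // .inl r ∉ L i ∧ rblk i r = j} := fun i j => by
    have : s ⟨i.succ, j⟩ = 0 := if_neg fun he => by
      exact i.succ_ne_zero (congrArg Sigma.fst he)
    simp only [ℓ, hbal, this, add_zero]
    rw [Fintype.card_sigma_subtype_eq (fun i' r => ⟨i', .inl r⟩ ∉ B ∧
      (⟨i'.succ, rblk i' r⟩ : Σ k, Fin (m k)) = ⟨i.succ, j⟩) i fun i' c hc =>
      Fin.succ_injective _ (congrArg Sigma.fst hc.2)]
    exact Fintype.card_congr (Equiv.subtypeEquivRight fun c => by simp [L])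
  have hfirst : ℓ 0 = fun _ => R := by
    ext j
    obtain rfl := hS j
    have : IsEmpty {e : Σ i, ρ i // ⟨e.1, .inl e.2⟩ ∉ B ∧
        (⟨e.1.succ, rblk e.1 e.2⟩ : Σ k, Fin (m k)) = ⟨0, j⟩} :=
      ⟨fun e => e.1.1.succ_ne_zero (congrArg Sigma.fst e.2.2)⟩
    simp only [ℓ, hbal, Fintype.card_eq_zero, zero_add]
    exact if_pos rfl
  have hlast : ℓ (Fin.last M) = fun _ => R := by
    ext j
    obtain rfl := hD j
    have : IsEmpty {e : Σ i, γ i // ⟨e.1, .inr e.2⟩ ∈ B ∧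
        (⟨e.1.castSucc, cblk e.1 e.2⟩ : Σ k, Fin (m k)) = ⟨Fin.last M, j⟩} :=
      ⟨fun e => (Fin.castSucc_lt_last e.1.1).ne (congrArg Sigma.fst e.2.2)⟩
    simp only [ℓ, Fintype.card_eq_zero, zero_add]
    exact if_pos rfl
  have hcolsum : ∀ i, Fintype.card {c // .inr c ∈ L i} = ∑ j, ℓ i.castSucc j := fun i => by
    simp only [hcol]
    exact Fintype.card_subtype_eq_sum_fiber _ (cblk i)
  have hrowsum : ∀ i, Fintype.card {r // .inl r ∉ L i} = ∑ j, ℓ i.succ j := fun i => by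
    simp only [hrow]
    exact Fintype.card_subtype_eq_sum_fiber _ (rblk i)
  have hmono : Monotone fun k => ∑ j, ℓ k j := Fin.monotone_iff_le_succ.2 fun i => by
    rw [← hcolsum, ← hrowsum]
    exact card_inr_le_card_inl_compl (hL i)
  have hrate : ∀ k, ∑ j, ℓ k j = R := fun k => by
    have h0 : ∑ j, ℓ 0 j = R := by
      rw [hfirst, Fintype.sum_eq_single S fun j hj => absurd (hS j) hj]
    have h1 : ∑ j, ℓ (Fin.last M) j = R := by
      rw [hlast, Fintype.sum_eq_single D fun j hj => absurd (hD j) hj]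
    exact le_antisymm ((hmono (Fin.le_last k)).trans_eq h1) (h0.ge.trans (hmono (Fin.zero_le k)))
  refine ⟨ℓ, hfirst, hlast, fun i => ?_⟩
  convert supportsFlow_of_linearIndepOn_augCol (hL i) (rblk i) (cblk i)
    ((hrowsum i).trans (hrate _)) ((hcolsum i).trans (hrate _)) using 1
  · exact funext (hcol i)
  · exact funext (hrow i)

theorem netSupports_of_le_cutCap (hM : 1 ≤ M) {S : Fin (m 0)} {D : Fin (m (Fin.last M))}
    (hS : ∀ j, j = S) (hD : ∀ j, j = D) {R : ℕ}
    (h : ∀ Ω : ∀ i : Fin (M + 1), Finset (Fin (m i)), S ∈ Ω 0 → D ∉ Ω (Fin.last M) →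
      R ≤ cutCap G rblk cblk Ω) :
    NetSupports G rblk cblk (fun _ => R) (fun _ => R) R := by
  classical
  let src : Σ k, Fin (m k) := ⟨0, S⟩
  let dst : Σ k, Fin (m k) := ⟨Fin.last M, D⟩
  have hne : src ≠ dst := fun he => by
    have := congrArg (fun v : Σ k, Fin (m k) => (v.1 : ℕ)) he
    simp [src, dst] at this
    omega
  let s : (Σ k, Fin (m k)) → ℕ := fun v => if v = src then R else 0
  let t : (Σ k, Fin (m k)) → ℕ := fun v => if v = dst then R else 0
  have hcut : ∀ J : Finset (Σ k, Fin (m k)), src ∈ J → dst ∉ J →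
      R ≤ cutCap G rblk cblk (fun k => {j | ⟨k, j⟩ ∈ J}) := fun J hJs hJd =>
    h _ (by simpa using hJs) (by simpa using hJd)
  have hdst : R ≤ rowCount rblk dst := by
    refine ((hcut {dst}ᶜ (by simpa using hne) (by simp)).trans
      (cutCap_le_sum_rowCount _)).trans ?_
    simp
  have ht : ∀ v, t v ≤ rowCount rblk v := fun v => by
    by_cases hv : v = dst
    · simpa [t, hv] using hdst
    · simp [t, hv]
  let n : (Σ k, Fin (m k)) → ℕ := fun v => rowCount rblk v + s v - t v
  have hn : ∀ v, n v + t v = rowCount rblk v + s v := fun v =>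
    Nat.sub_add_cancel ((ht v).trans (Nat.le_add_right _ _))
  obtain ⟨B, hB, hBn⟩ := exists_linearIndepOn_card_fiber_eq (netCol G) (netNode rblk cblk) n
    fun J => by
      refine le_trans ?_ (cutCap_add_sum_rowCount_le J)
      have hsum : ∑ v ∈ J, n v + ∑ v ∈ J, t v = ∑ v ∈ J, rowCount rblk v + ∑ v ∈ J, s v := by
        simp only [← Finset.sum_add_distrib, hn]
      simp only [s, t, Finset.sum_ite_eq'] at hsum
      have := hcut J
      split_ifs at hsum <;> grind
  refine netSupports_of_linearIndepOn_netCol hS hD hB fun v => ?_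
  have h1 := card_netNode_fiber_add (rblk := rblk) (cblk := cblk) B v
  have h2 := hn v
  rw [hBn] at h1
  change _ + t v = _ + s v
  omega

end Network

/-- **Max-flow/min-cut for linear deterministic relay networks.** Let `N` be a layered linear
deterministic network over a finite field with a single source node `S` in the first layer and a
single destination node `D` in the last layer, and let
`C = min { C(Ω) : Ω a cut with S ∈ Ω, D ∉ Ω }` be its capacity.  Then for every nonnegative
integer `R`, the network supports the rate-`R` flow `d = (R; R)` if and only if `R ≤ C`. -/
theorem stmt_2 {F : Type*} [Field F] [Fintype F] {M : ℕ} (hM : 1 ≤ M)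
    {m : Fin (M + 1) → ℕ} {ρ γ : Fin M → Type*}
    [∀ i, Fintype (ρ i)] [∀ i, Fintype (γ i)]
    (G : ∀ i : Fin M, Matrix (ρ i) (γ i) F)
    (rblk : ∀ i : Fin M, ρ i → Fin (m i.succ))
    (cblk : ∀ i : Fin M, γ i → Fin (m i.castSucc))
    (hfirst : m 0 = 1) (hlast : m (Fin.last M) = 1) (R : ℕ) :
    NetSupports G rblk cblk (fun _ => R) (fun _ => R) R ↔
      R ≤ sInf {c : ℕ | ∃ Ω : ∀ i : Fin (M + 1), Finset (Fin (m i)),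
        (⟨0, by omega⟩ : Fin (m 0)) ∈ Ω 0 ∧
        (⟨0, by omega⟩ : Fin (m (Fin.last M))) ∉ Ω (Fin.last M) ∧
        cutCap G rblk cblk Ω = c} := by
  have hS : ∀ j : Fin (m 0), j = ⟨0, by omega⟩ := fun j => Fin.ext (by simp; omega)
  have hD : ∀ j : Fin (m (Fin.last M)), j = ⟨0, by omega⟩ := fun j => Fin.ext (by simp; omega)
  constructor
  · intro h
    refine le_csInf ⟨_, fun i => if i = 0 then Finset.univ else ∅, by simp, ?_, rfl⟩ ?_
    · have : Fin.last M ≠ 0 := by simp [Fin.ext_iff]; omega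
      simp [this]
    · rintro _ ⟨Ω, hSΩ, hDΩ, rfl⟩
      have hcut := h.sum_first_le Ω
      rw [Finset.eq_empty_of_forall_notMem fun j hj => hDΩ (hD j ▸ hj), Finset.sum_empty] at hcut
      exact (Finset.single_le_sum (f := fun _ => R) (fun _ _ => Nat.zero_le _) hSΩ).trans hcut
  · intro h
    exact netSupports_of_le_cutCap hM hS hD fun Ω hSΩ hDΩ =>
      h.trans (Nat.sInf_le ⟨Ω, hSΩ, hDΩ, rfl⟩)
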